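/- Let β > 1 have generating sequence g(β) that is eventually periodic but not periodic, with n ≥ 1 and p ≥ 1 minimal such that g(β) = g_1 ⋯ g_n (g_{n+1} ⋯ g_{n+p})^∞, and let F_β be the Fischer graph. For a left-ray y : ℕ → ℕ (encoding the left-infinite word ⋯ y_1 y_0), let r(y) denote the set of vertices u of F_β such that some left-infinite path labeled y terminates at u. Then |r(y)| ≤ 2 for every left-ray y of X_β, and |r(y)| = 2 if and only if there exists 0 ≤ k < p such that y_j = g_{n+1+((k−1−j) mod p)} for all j ≥ 0 (i.e., y is the left-infinite word (g_{n+1} ⋯ g_{n+p})^∞ g_{n+1} ⋯ g_{n+k}). -/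

import Mathlib

/-- The remainders `r_n(t)` of the β-expansion of `t` (0-indexed: `betaRem β t n = r_n(t)`). -/
noncomputable def betaRem (β t : ℝ) : ℕ → ℝ
  | 0 => t
  | n + 1 => Int.fract (β * betaRem β t n)

/-- `betaDigit β t n` is the digit `x_{n+1}(t)` of the β-expansion of `t` (0-indexed). -/
noncomputable def betaDigit (β t : ℝ) (n : ℕ) : ℕ :=
  (⌊β * betaRem β t n⌋).toNat

/- The generating sequence `g(β)`, 0-indexed: `genSeq β i = g_{i+1}`.
If `e(β)` is eventually zero with last nonzero digit at (0-indexed) position `k`,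
then `g(β)` is the periodic sequence of period `k+1` obtained from the initial word
of `e(β)` of length `k+1` by decreasing its last letter by one; otherwise `g(β) = e(β)`. -/
open scoped Classical in
noncomputable def genSeq (β : ℝ) : ℕ → ℕ :=
  if h : ∃ k, betaDigit β 1 k ≠ 0 ∧ ∀ m, k < m → betaDigit β 1 m = 0 then
    fun i =>
      if i % (Nat.find h + 1) = Nat.find h then betaDigit β 1 (Nat.find h) - 1
      else betaDigit β 1 (i % (Nat.find h + 1))
  else
    betaDigit β 1

/-- Strict lexicographic order on one-sided sequences. -/
def lexLt (x y : ℕ → ℕ) : Prop :=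
  ∃ n, (∀ i < n, x i = y i) ∧ x n < y n

/-- Lexicographic order on one-sided sequences. -/
def lexLe (x y : ℕ → ℕ) : Prop :=
  x = y ∨ lexLt x y

/-- Membership in the beta-shift `X_β` (bi-infinite sequences). -/
def memBeta (β : ℝ) (x : ℤ → ℕ) : Prop :=
  ∀ k : ℤ, lexLe (fun n : ℕ => x (k + n)) (genSeq β)

/-- Membership in the right-ray space `X_β⁺`. -/
def rightRay (β : ℝ) (x : ℕ → ℕ) : Prop :=
  ∀ k : ℕ, lexLe (fun n : ℕ => x (k + n)) (genSeq β)

/-- The edge relation of the Fischer graph `F_β` of a sofic beta-shift whose generating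
sequence is `g = g_1 g_2 ⋯` (0-indexed: `g i = g_{i+1}`) with minimal decomposition
`g(β) = g_1 ⋯ g_n (g_{n+1} ⋯ g_{n+p})^∞`.  `fischerEdge g n p a i j` says that there is
an edge labeled `a` from vertex `i` to vertex `j` (vertices are `1, …, n+p`). -/
def fischerEdge (g : ℕ → ℕ) (n p : ℕ) (a i j : ℕ) : Prop :=
  1 ≤ i ∧ i ≤ n + p ∧
    ((a < g (i - 1) ∧ j = 1) ∨
     (a = g (i - 1) ∧ i < n + p ∧ j = i + 1) ∨
     (a = g (i - 1) ∧ i = n + p ∧ j = n + 1))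

/-- `y : ℕ → ℕ` encodes a left-ray `⋯ y_1 y_0` of `X_β`. -/
def leftRay (β : ℝ) (y : ℕ → ℕ) : Prop :=
  ∃ x : ℤ → ℕ, memBeta β x ∧ ∀ j : ℕ, x (-1 - j) = y j

/-- `r(y)`: the set of vertices of the Fischer graph where some left-infinite path
labeled `⋯ y_1 y_0` terminates. -/
def termSet (g : ℕ → ℕ) (n p : ℕ) (y : ℕ → ℕ) : Set ℕ :=
  { u | ∃ v : ℕ → ℕ, v 0 = u ∧ ∀ j : ℕ, fischerEdge g n p (y j) (v (j + 1)) (v j) }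

/-- The vertex reached from vertex `1` by following `c` consecutive non-resetting edges. -/
def fischerVertex (n p c : ℕ) : ℕ :=
  if c < n then c + 1 else n + 1 + (c - n) % p

/-- `v` is a left-infinite path labeled `y` in the Fischer graph. -/
def IsLeftPath (g : ℕ → ℕ) (n p : ℕ) (y v : ℕ → ℕ) : Prop :=
  ∀ j : ℕ, fischerEdge g n p (y j) (v (j + 1)) (v j)

/-- `g 0 ⋯ g (d - 1)` is a suffix of `g 0 ⋯ g (e - 1)`. -/
def PrefixIsSuffix (g : ℕ → ℕ) (e d : ℕ) : Prop :=
  ∃ c, e = c + d ∧ ∀ i < d, g (c + i) = g i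

/-- A sequence dominating all its shifts: once a shift agrees with the sequence on a prefix,
its next letter is at most the next letter of the sequence. -/
def ShiftMaximal (g : ℕ → ℕ) : Prop :=
  ∀ c m : ℕ, (∀ i < m, g (c + i) = g i) → g (c + m) ≤ g m

section BetaExpansion

theorem betaRem_add (β t : ℝ) (k m : ℕ) :
    betaRem β t (k + m) = betaRem β (betaRem β t k) m := by
  induction m with
  | zero => rfl
  | succ m ih => rw [← Nat.add_assoc]; simp only [betaRem, ih]

theorem betaDigit_add (β t : ℝ) (k m : ℕ) :
    betaDigit β t (k + m) = betaDigit β (betaRem β t k) m := by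
  simp only [betaDigit, betaRem_add]

theorem betaRem_one_mem (β : ℝ) (k : ℕ) : 0 ≤ betaRem β 1 k ∧ betaRem β 1 k ≤ 1 := by
  cases k with
  | zero => simp [betaRem]
  | succ k => exact ⟨Int.fract_nonneg _, (Int.fract_lt_one _).le⟩

theorem betaRem_nonneg {β t : ℝ} (ht : 0 ≤ t) (k : ℕ) : 0 ≤ betaRem β t k := by
  cases k with
  | zero => exact ht
  | succ k => exact Int.fract_nonneg _

theorem betaRem_mono {β s t : ℝ} (hβ : 0 ≤ β) (hs : 0 ≤ s) (hst : s ≤ t) (m : ℕ)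
    (h : ∀ i < m, betaDigit β s i = betaDigit β t i) : betaRem β s m ≤ betaRem β t m := by
  induction m with
  | zero => exact hst
  | succ m ih =>
    have hm := ih fun i hi => h i (by omega)
    have hd := h m (by omega)
    have hs' := mul_nonneg hβ (betaRem_nonneg (β := β) hs m)
    have ht' := mul_nonneg hβ (betaRem_nonneg (β := β) (hs.trans hst) m)
    have hfl : ⌊β * betaRem β s m⌋ = ⌊β * betaRem β t m⌋ := by
      have h1 := Int.floor_nonneg.2 hs'
      have h2 := Int.floor_nonneg.2 ht'
      unfold betaDigit at hd
      omega
    simp only [betaRem, Int.fract, hfl]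
    have := mul_le_mul_of_nonneg_left hm hβ
    linarith

theorem shiftMaximal_betaDigit_one {β : ℝ} (hβ : 0 ≤ β) : ShiftMaximal (betaDigit β 1) := by
  intro c m h
  simp only [betaDigit_add] at h ⊢
  have hc := betaRem_one_mem β c
  exact Int.toNat_le_toNat (Int.floor_le_floor
    (mul_le_mul_of_nonneg_left (betaRem_mono hβ hc.1 hc.2 m h) hβ))

theorem shiftMaximal_genSeq_of_not_periodic {β : ℝ} (hβ : 0 ≤ β)
    (h : ¬ ∃ p, 1 ≤ p ∧ ∀ k, genSeq β (k + p) = genSeq β k) : ShiftMaximal (genSeq β) := by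
  have hne : ¬ ∃ k, betaDigit β 1 k ≠ 0 ∧ ∀ m, k < m → betaDigit β 1 m = 0 := by
    intro hz
    classical
    refine h ⟨Nat.find hz + 1, Nat.le_add_left 1 _, fun k => ?_⟩
    unfold genSeq
    simp only [dif_pos hz]
    convert rfl using 3 <;> simp
  have hg : genSeq β = betaDigit β 1 := by
    unfold genSeq
    rw [dif_neg hne]
  rw [hg]
  exact shiftMaximal_betaDigit_one hβ

end BetaExpansion

section FischerGraph

variable {g : ℕ → ℕ} {n p : ℕ}

theorem apply_add_congr_mod (hper : ∀ k, n ≤ k → g (k + p) = g k) {a b : ℕ}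
    (h : a ≡ b [MOD p]) : g (n + a) = g (n + b) := by
  have key : ∀ s t, g (n + s + p * t) = g (n + s) := by
    intro s t
    induction t with
    | zero => simp
    | succ t ih => rw [Nat.mul_succ, ← Nat.add_assoc, hper _ (by omega), ih]
  have h1 := key (a % p) (a / p)
  have h2 := key (b % p) (b / p)
  rw [Nat.add_assoc, Nat.mod_add_div] at h1 h2
  rw [h1, h2, h]

theorem fischerVertex_add (n p a : ℕ) : fischerVertex n p (n + a) = n + 1 + a % p := by
  simp [fischerVertex]

theorem fischerVertex_zero (hn : 1 ≤ n) : fischerVertex n p 0 = 1 := by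
  simp [fischerVertex, show 0 < n by omega]

theorem eq_zero_of_fischerVertex_eq_one (hn : 1 ≤ n) {c : ℕ} (h : fischerVertex n p c = 1) :
    c = 0 := by
  unfold fischerVertex at h
  split_ifs at h <;> omega

theorem fischerVertex_sub_one {i : ℕ} (hi : 1 ≤ i) (hi' : i ≤ n + p) :
    fischerVertex n p (i - 1) = i := by
  unfold fischerVertex
  split_ifs
  · omega
  · rw [Nat.mod_eq_of_lt (by omega)]; omega

theorem apply_fischerVertex_sub_one (hper : ∀ k, n ≤ k → g (k + p) = g k) (c : ℕ) :
    g (fischerVertex n p c - 1) = g c := by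
  unfold fischerVertex
  split_ifs with h
  · simp
  · have := apply_add_congr_mod hper (Nat.mod_modEq (c - n) p)
    rw [show n + (c - n) = c by omega] at this
    rw [← this]
    congr 1
    omega

theorem fischerVertex_succ (hp : 1 ≤ p) (c : ℕ) :
    (fischerVertex n p c < n + p ∧ fischerVertex n p (c + 1) = fischerVertex n p c + 1) ∨
      (fischerVertex n p c = n + p ∧ fischerVertex n p (c + 1) = n + 1) := by
  rcases lt_or_ge c n with h | h
  · left
    rcases eq_or_lt_of_le (show c + 1 ≤ n from h) with h' | h'
    · simp [fischerVertex, ← h']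
      omega
    · simp [fischerVertex, h, h']
      omega
  · obtain ⟨a, rfl⟩ := Nat.exists_eq_add_of_le h
    rw [Nat.add_assoc, fischerVertex_add, fischerVertex_add]
    have hlt := Nat.mod_lt a hp
    rcases eq_or_lt_of_le (show a % p + 1 ≤ p from hlt) with h' | h'
    · right
      refine ⟨by omega, ?_⟩
      rw [← Nat.mod_add_mod, h', Nat.mod_self]
    · left
      refine ⟨by omega, ?_⟩
      rw [← Nat.mod_add_mod, Nat.mod_eq_of_lt h']
      omega

theorem fischerVertex_mem (hp : 1 ≤ p) (c : ℕ) :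
    1 ≤ fischerVertex n p c ∧ fischerVertex n p c ≤ n + p := by
  unfold fischerVertex
  have := Nat.mod_lt (c - n) hp
  split_ifs <;> omega

theorem fischerEdge_fischerVertex_iff (hp : 1 ≤ p) (hper : ∀ k, n ≤ k → g (k + p) = g k)
    (a c u : ℕ) : fischerEdge g n p a (fischerVertex n p c) u ↔
      (a < g c ∧ u = 1) ∨ (a = g c ∧ u = fischerVertex n p (c + 1)) := by
  have hm := fischerVertex_mem (n := n) hp c
  have hs := fischerVertex_succ (n := n) hp c
  unfold fischerEdge
  rw [apply_fischerVertex_sub_one hper]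
  omega

theorem ShiftMaximal.apply_le (hg : ShiftMaximal g) {e d : ℕ} (h : PrefixIsSuffix g e d) :
    g e ≤ g d := by
  obtain ⟨c, rfl, h⟩ := h
  exact hg c d h

theorem prefixIsSuffix_zero (g : ℕ → ℕ) (e : ℕ) : PrefixIsSuffix g e 0 :=
  ⟨e, rfl, by simp⟩

theorem PrefixIsSuffix.succ {e d : ℕ} (h : PrefixIsSuffix g e d) (hed : g e = g d) :
    PrefixIsSuffix g (e + 1) (d + 1) := by
  obtain ⟨c, rfl, h⟩ := h
  refine ⟨c, by omega, fun i hi => ?_⟩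
  rcases eq_or_lt_of_le (Nat.lt_succ_iff.1 hi) with rfl | hi
  · exact hed
  · exact h i hi

theorem fischerEdge_right_unique {a i u u' : ℕ} (h : fischerEdge g n p a i u)
    (h' : fischerEdge g n p a i u') : u = u' := by
  unfold fischerEdge at h h'
  omega

theorem fischerEdge_left_unique (hlast : g (n - 1) ≠ g (n + p - 1))
    {a i i' u : ℕ} (hu : u ≠ 1) (h : fischerEdge g n p a i u)
    (h' : fischerEdge g n p a i' u) : i = i' := by
  by_contra hne
  unfold fischerEdge at h h'
  rcases (show (i = n ∧ i' = n + p) ∨ (i = n + p ∧ i' = n) by omega) with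
    ⟨rfl, rfl⟩ | ⟨rfl, rfl⟩ <;> omega

theorem fischerEdge_dominate (hp : 1 ≤ p) (hn : 1 ≤ n)
    (hper : ∀ k, n ≤ k → g (k + p) = g k) (hg : ShiftMaximal g) {a e d u u' : ℕ}
    (hed : PrefixIsSuffix g e d) (h' : fischerEdge g n p a (fischerVertex n p e) u')
    (h : fischerEdge g n p a (fischerVertex n p d) u) :
    ∃ e' d', PrefixIsSuffix g e' d' ∧ fischerVertex n p e' = u' ∧ fischerVertex n p d' = u := by
  rw [fischerEdge_fischerVertex_iff hp hper] at h h'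
  have hle := hg.apply_le hed
  rcases h with ⟨hlt, rfl⟩ | ⟨heq, rfl⟩
  · rcases h' with ⟨-, rfl⟩ | ⟨-, rfl⟩
    · exact ⟨0, 0, prefixIsSuffix_zero g 0, fischerVertex_zero hn, fischerVertex_zero hn⟩
    · exact ⟨e + 1, 0, prefixIsSuffix_zero g _, rfl, fischerVertex_zero hn⟩
  · rcases h' with ⟨hlt', rfl⟩ | ⟨heq', rfl⟩
    · omega
    · exact ⟨e + 1, d + 1, hed.succ (by omega), rfl, rfl⟩

variable {y v v' : ℕ → ℕ}

theorem IsLeftPath.mem (h : IsLeftPath g n p y v) (j : ℕ) : 1 ≤ v (j + 1) ∧ v (j + 1) ≤ n + p :=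
  ⟨(h j).1, (h j).2.1⟩

theorem IsLeftPath.zero_eq_of_eq (h : IsLeftPath g n p y v) (h' : IsLeftPath g n p y v') {j : ℕ}
    (hj : v j = v' j) : v 0 = v' 0 := by
  induction j with
  | zero => exact hj
  | succ j ih => exact ih (fischerEdge_right_unique (h j) (hj ▸ h' j))

theorem IsLeftPath.eq_one_of_eq_one (hp : 1 ≤ p) (hn : 1 ≤ n)
    (hper : ∀ k, n ≤ k → g (k + p) = g k) (hg : ShiftMaximal g)
    (h : IsLeftPath g n p y v) (h' : IsLeftPath g n p y v') {j l : ℕ} (hlj : l ≤ j)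
    (hj : v j = 1) (hl : v' l = 1) : v l = 1 := by
  rcases eq_or_lt_of_le hlj with rfl | hlt
  · exact hj
  have key : ∀ m, m ≤ j → ∃ e d, PrefixIsSuffix g e d ∧
      fischerVertex n p e = v' (j - m) ∧ fischerVertex n p d = v (j - m) := by
    intro m
    induction m with
    | zero =>
      intro _
      obtain ⟨i, rfl⟩ : ∃ i, j = i + 1 := ⟨j - 1, by omega⟩
      have hm := h'.mem i
      exact ⟨v' (i + 1) - 1, 0, prefixIsSuffix_zero g _, fischerVertex_sub_one hm.1 hm.2,
        (fischerVertex_zero hn).trans hj.symm⟩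
    | succ m ih =>
      intro hm
      obtain ⟨e, d, hed, he, hd⟩ := ih (by omega)
      have e1 := h (j - (m + 1))
      have e2 := h' (j - (m + 1))
      rw [show j - (m + 1) + 1 = j - m by omega, ← hd] at e1
      rw [show j - (m + 1) + 1 = j - m by omega, ← he] at e2
      exact fischerEdge_dominate hp hn hper hg hed e2 e1
  obtain ⟨e, d, hed, he, hd⟩ := key (j - l) (by omega)
  rw [show j - (j - l) = l by omega] at he hd
  have he0 := eq_zero_of_fischerVertex_eq_one hn (he.trans hl)
  obtain ⟨c, hc, -⟩ := hed
  rw [← hd, show d = 0 by omega, fischerVertex_zero hn]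

/-- Two left-infinite paths with the same label that both visit vertex `1` have the same end. -/
theorem IsLeftPath.zero_eq_of_visit_one (hp : 1 ≤ p) (hn : 1 ≤ n)
    (hper : ∀ k, n ≤ k → g (k + p) = g k) (hg : ShiftMaximal g)
    (h : IsLeftPath g n p y v) (h' : IsLeftPath g n p y v')
    (hv : ∃ j, v j = 1) (hv' : ∃ j, v' j = 1) : v 0 = v' 0 := by
  obtain ⟨j, hj⟩ := hv
  obtain ⟨l, hl⟩ := hv'
  rcases le_total l j with hlj | hlj
  · exact h.zero_eq_of_eq h' ((h.eq_one_of_eq_one hp hn hper hg h' hlj hj hl).trans hl.symm)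
  · exact h.zero_eq_of_eq h' (hj.trans (h'.eq_one_of_eq_one hp hn hper hg h hlj hl hj).symm)

theorem IsLeftPath.lt_of_forall_ne_one (h : IsLeftPath g n p y v) (hv : ∀ j, v j ≠ 1) (j : ℕ) :
    n + 1 ≤ v j := by
  have key : ∀ i j, v j = i → n + 1 ≤ i := by
    intro i
    induction i with
    | zero =>
      intro j hj
      have := h j
      unfold fischerEdge at this
      omega
    | succ i ih =>
      intro j hj
      by_contra hlt
      have e := h j
      have h1 := hv j
      unfold fischerEdge at e
      have := ih (j + 1) (by omega)
      omega
  exact key _ j rfl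

/-- A left-infinite path avoiding vertex `1` winds around the cycle of the Fischer graph. -/
theorem IsLeftPath.exists_eq_fischerVertex (hp : 1 ≤ p)
    (hper : ∀ k, n ≤ k → g (k + p) = g k) (h : IsLeftPath g n p y v) (hv : ∀ j, v j ≠ 1) :
    ∃ k < p, v 0 = n + 1 + k ∧ ∀ j, y j = g (n + (k + (j + 1) * (p - 1))) := by
  have hrep : ∀ j, ∃ k, v (j + 1) = fischerVertex n p (n + k) := fun j => by
    have h1 := h.mem j
    have h2 := h.lt_of_forall_ne_one hv (j + 1)
    refine ⟨v (j + 1) - 1 - n, ?_⟩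
    rw [show n + (v (j + 1) - 1 - n) = v (j + 1) - 1 by omega,
      fischerVertex_sub_one h1.1 h1.2]
  have hstep : ∀ j k, v (j + 1) = fischerVertex n p (n + k) →
      y j = g (n + k) ∧ v j = fischerVertex n p (n + k + 1) := fun j k hk => by
    have e := h j
    rw [hk, fischerEdge_fischerVertex_iff hp hper] at e
    exact e.resolve_left fun e => hv j e.2
  have hback : ∀ j k, v j = fischerVertex n p (n + k) →
      v (j + 1) = fischerVertex n p (n + (k + (p - 1))) := fun j k hk => by
    obtain ⟨k', hk'⟩ := hrep j
    have h2 := (hstep j k' hk').2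
    rw [hk', fischerVertex_add, fischerVertex_add]
    rw [hk, Nat.add_assoc n k' 1, fischerVertex_add, fischerVertex_add] at h2
    have h3 : k' + 1 ≡ k + (p - 1) + 1 [MOD p] := by
      rw [show k + (p - 1) + 1 = k + p by omega]
      unfold Nat.ModEq
      rw [Nat.add_mod_right]
      omega
    rw [show k' % p = (k + (p - 1)) % p from Nat.ModEq.add_right_cancel' 1 h3]
  have h0 : n + 1 ≤ v 0 ∧ v 0 ≤ n + p := by
    refine ⟨h.lt_of_forall_ne_one hv 0, ?_⟩
    obtain ⟨k, hk⟩ := hrep 0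
    rw [(hstep 0 k hk).2]
    exact (fischerVertex_mem hp _).2
  refine ⟨v 0 - (n + 1), by omega, by omega, fun j => ?_⟩
  have hall : ∀ j, v j = fischerVertex n p (n + (v 0 - (n + 1) + j * (p - 1))) := by
    intro j
    induction j with
    | zero =>
      rw [fischerVertex_add, Nat.zero_mul, Nat.add_zero, Nat.mod_eq_of_lt (by omega)]
      omega
    | succ j ih =>
      rw [hback j _ ih, Nat.add_mul, Nat.one_mul, Nat.add_assoc (v 0 - (n + 1))]
  exact (hstep j _ (hall (j + 1))).1

theorem not_lt_of_periodic_labels_eq (hp : 1 ≤ p) (hper : ∀ k, n ≤ k → g (k + p) = g k)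
    (hmin : ∀ p', 1 ≤ p' → (∀ k, n ≤ k → g (k + p') = g k) → p ≤ p') {k k' : ℕ} (hk' : k' < p)
    (h : ∀ j, g (n + (k + (j + 1) * (p - 1))) = g (n + (k' + (j + 1) * (p - 1)))) :
    ¬ k < k' := by
  intro hlt
  obtain ⟨q, rfl⟩ : ∃ q, p = q + 1 := ⟨p - 1, by omega⟩
  obtain ⟨d, rfl⟩ := Nat.exists_eq_add_of_lt hlt
  have hd := hmin (d + 1) (by omega) fun m hm => by
    obtain ⟨s, rfl⟩ := Nat.exists_eq_add_of_le hm
    have hj := h (k + s * q + q)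
    have hs : k + (k + s * q + q + 1) * q ≡ s [MOD q + 1] := by
      rw [← Int.natCast_modEq_iff]
      refine (Int.modEq_iff_dvd.2 ⟨k + s * (q - 1) + q, ?_⟩).symm
      push_cast
      ring
    rw [Nat.add_sub_cancel, apply_add_congr_mod hper hs,
      show k + d + 1 + (k + s * q + q + 1) * q = k + (k + s * q + q + 1) * q + (d + 1) by ring,
      apply_add_congr_mod hper (hs.add_right (d + 1))] at hj
    rw [Nat.add_assoc, ← hj]
  omega

theorem isLeftPath_cycle (hp : 1 ≤ p) (hper : ∀ k, n ≤ k → g (k + p) = g k) {k : ℕ}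
    (hy : ∀ j, y j = g (n + (k + (j + 1) * (p - 1)))) :
    IsLeftPath g n p y fun j => fischerVertex n p (n + (k + j * (p - 1))) := by
  intro j
  rw [fischerEdge_fischerVertex_iff hp hper]
  refine Or.inr ⟨hy j, ?_⟩
  obtain ⟨q, rfl⟩ : ∃ q, p = q + 1 := ⟨p - 1, by omega⟩
  beta_reduce
  rw [Nat.add_sub_cancel, Nat.add_assoc n, fischerVertex_add, fischerVertex_add,
    show k + (j + 1) * q + 1 = k + j * q + (q + 1) by ring, Nat.add_mod_right]

/-- The counters met when reading the word `g n, g (n + 1), …` from vertex `1`. -/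
def readCounter (g : ℕ → ℕ) (n : ℕ) : ℕ → ℕ
  | 0 => 0
  | t + 1 => if g (n + t) < g (readCounter g n t) then 0 else readCounter g n t + 1

theorem prefixIsSuffix_readCounter (hg : ShiftMaximal g) (n t : ℕ) :
    PrefixIsSuffix g (n + t) (readCounter g n t) := by
  induction t with
  | zero => exact prefixIsSuffix_zero g _
  | succ t ih =>
    simp only [readCounter]
    split_ifs with h
    · exact prefixIsSuffix_zero g _
    · exact ih.succ (le_antisymm (hg.apply_le ih) (not_lt.1 h))

theorem fischerEdge_readCounter (hp : 1 ≤ p) (hn : 1 ≤ n)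
    (hper : ∀ k, n ≤ k → g (k + p) = g k) (hg : ShiftMaximal g) (t : ℕ) :
    fischerEdge g n p (g (n + t)) (fischerVertex n p (readCounter g n t))
      (fischerVertex n p (readCounter g n (t + 1))) := by
  rw [fischerEdge_fischerVertex_iff hp hper]
  simp only [readCounter]
  have := hg.apply_le (prefixIsSuffix_readCounter hg n t)
  split_ifs with h
  · exact Or.inl ⟨h, fischerVertex_zero hn⟩
  · exact Or.inr ⟨by omega, rfl⟩

theorem fischerVertex_readCounter_ne (hp : 1 ≤ p) (hn : 1 ≤ n)
    (hper : ∀ k, n ≤ k → g (k + p) = g k) (hg : ShiftMaximal g)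
    (hlast : g (n - 1) ≠ g (n + p - 1)) (t : ℕ) :
    fischerVertex n p (readCounter g n t) ≠ fischerVertex n p (n + t) := by
  induction t with
  | zero =>
    rw [fischerVertex_add]
    simp only [readCounter]
    rw [fischerVertex_zero hn]
    omega
  | succ t ih =>
    intro h
    have h1 := fischerEdge_readCounter hp hn hper hg t
    have h2 := (fischerEdge_fischerVertex_iff hp hper (g (n + t)) (n + t) _).2 (Or.inr ⟨rfl, rfl⟩)
    rw [h] at h1
    refine ih (fischerEdge_left_unique hlast ?_ h1 h2)
    rw [fischerVertex_add]
    omega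

/-- Besides the path winding around the cycle, a second path with the same label. -/
theorem exists_isLeftPath_ne_cycle (hp : 1 ≤ p) (hn : 1 ≤ n)
    (hper : ∀ k, n ≤ k → g (k + p) = g k) (hg : ShiftMaximal g)
    (hlast : g (n - 1) ≠ g (n + p - 1)) {k : ℕ}
    (hy : ∀ j, y j = g (n + (k + (j + 1) * (p - 1)))) :
    ∃ v, IsLeftPath g n p y v ∧ v 0 ≠ fischerVertex n p (n + k) := by
  set u : ℕ → ℕ := fun t => fischerVertex n p (readCounter g n t) with hu
  have hedge : ∀ t, fischerEdge g n p (g (n + t)) (u t) (u (t + 1)) :=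
    fischerEdge_readCounter hp hn hper hg
  obtain ⟨m, r, hr, hmr⟩ : ∃ m r, 1 ≤ r ∧ u (p * m) = u (p * (m + r)) := by
    let f : ℕ → Fin (n + p + 1) := fun m =>
      ⟨u (p * m), Nat.lt_succ_of_le (fischerVertex_mem hp _).2⟩
    obtain ⟨a, b, hab, hf⟩ := Finite.exists_ne_map_eq_of_infinite f
    have hf' : u (p * a) = u (p * b) := congrArg Fin.val hf
    rcases lt_or_gt_of_ne hab with h | h
    · exact ⟨a, b - a, by omega, by rwa [show a + (b - a) = b by omega]⟩
    · exact ⟨b, a - b, by omega, by rw [show b + (a - b) = a by omega]; exact hf'.symm⟩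
  have hperiod : ∀ s, u (p * m + s + p * r) = u (p * m + s) := by
    intro s
    induction s with
    | zero => rw [Nat.add_zero, ← Nat.mul_add, hmr]
    | succ s ih =>
      have h1 := hedge (p * m + s + p * r)
      rw [ih, apply_add_congr_mod hper (b := p * m + s) (by simp [Nat.ModEq])] at h1
      rw [show p * m + (s + 1) + p * r = p * m + s + p * r + 1 by ring]
      exact fischerEdge_right_unique h1 (hedge _)
  obtain ⟨w, hw⟩ : ∃ w, p * r = w + 1 := ⟨p * r - 1, by
    have := Nat.mul_le_mul hp hr
    omega⟩
  refine ⟨fun j => u (p * m + (k + j * w)), fun j => ?_, ?_⟩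
  · have h1 := hedge (p * m + (k + (j + 1) * w))
    rw [show p * m + (k + (j + 1) * w) + 1 = p * m + (k + j * w) + p * r by rw [hw]; ring,
      hperiod] at h1
    have hlabel : y j = g (n + (p * m + (k + (j + 1) * w))) := by
      rw [hy j]
      refine apply_add_congr_mod hper ?_
      rw [← Int.natCast_modEq_iff]
      refine Int.modEq_iff_dvd.2 ⟨m + (j + 1) * (r - 1), ?_⟩
      have hw' : (w : ℤ) = p * r - 1 := by
        have : (p : ℤ) * r = w + 1 := by exact_mod_cast hw
        omega
      push_cast [hw', Nat.cast_sub hp]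
      ring
    rw [hlabel]
    exact h1
  · have := fischerVertex_readCounter_ne hp hn hper hg hlast (p * m + k)
    rw [fischerVertex_add, Nat.mul_add_mod] at this
    simpa [hu, fischerVertex_add] using this

theorem ncard_termSet (hp : 1 ≤ p) (hn : 1 ≤ n)
    (hper : ∀ k, n ≤ k → g (k + p) = g k) (hg : ShiftMaximal g)
    (hmin : ∀ p', 1 ≤ p' → (∀ k, n ≤ k → g (k + p') = g k) → p ≤ p')
    (hlast : g (n - 1) ≠ g (n + p - 1)) (y : ℕ → ℕ) :
    (termSet g n p y).ncard ≤ 2 ∧ ((termSet g n p y).ncard = 2 ↔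
      ∃ k < p, ∀ j, y j = g (n + (k + (j + 1) * (p - 1)))) := by
  let A : Set ℕ := {a | ∃ v, v 0 = a ∧ IsLeftPath g n p y v ∧ ∀ j, v j ≠ 1}
  let B : Set ℕ := {a | ∃ v, v 0 = a ∧ IsLeftPath g n p y v ∧ ∃ j, v j = 1}
  have hAB : termSet g n p y ⊆ A ∪ B := by
    rintro a ⟨v, h0, hv⟩
    by_cases h1 : ∃ j, v j = 1
    · exact Or.inr ⟨v, h0, hv, h1⟩
    · exact Or.inl ⟨v, h0, hv, not_exists.1 h1⟩
  have hAs : A.Subsingleton := by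
    rintro _ ⟨v, rfl, hv, h1⟩ _ ⟨v', rfl, hv', h1'⟩
    obtain ⟨k, hk, h0, hy⟩ := hv.exists_eq_fischerVertex hp hper h1
    obtain ⟨k', hk', h0', hy'⟩ := hv'.exists_eq_fischerVertex hp hper h1'
    have := not_lt_of_periodic_labels_eq hp hper hmin hk' fun j => (hy j).symm.trans (hy' j)
    have := not_lt_of_periodic_labels_eq hp hper hmin hk fun j => (hy' j).symm.trans (hy j)
    omega
  have hBs : B.Subsingleton := by
    rintro _ ⟨v, rfl, hv, h1⟩ _ ⟨v', rfl, hv', h1'⟩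
    exact hv.zero_eq_of_visit_one hp hn hper hg hv' h1 h1'
  have hAf := hAs.finite
  have hBf := hBs.finite
  have hA1 : A.ncard ≤ 1 := (Set.ncard_le_one hAf).2 fun _ ha _ hb => hAs ha hb
  have hB1 : B.ncard ≤ 1 := (Set.ncard_le_one hBf).2 fun _ ha _ hb => hBs ha hb
  have hfin : (termSet g n p y).Finite := (hAf.union hBf).subset hAB
  have hle : (termSet g n p y).ncard ≤ 2 := by
    have h1 := Set.ncard_le_ncard hAB (hAf.union hBf)
    have h2 := Set.ncard_union_le A B
    omega
  refine ⟨hle, fun h2 => ?_, ?_⟩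
  · have hne : A.Nonempty := by
      by_contra hAe
      rw [Set.not_nonempty_iff_eq_empty.1 hAe, Set.empty_union] at hAB
      have := Set.ncard_le_ncard hAB hBf
      omega
    obtain ⟨_, v, -, hv, h1⟩ := hne
    obtain ⟨k, hk, -, hy⟩ := hv.exists_eq_fischerVertex hp hper h1
    exact ⟨k, hk, hy⟩
  · rintro ⟨k, -, hy⟩
    obtain ⟨v, hv, hne⟩ := exists_isLeftPath_ne_cycle hp hn hper hg hlast hy
    refine le_antisymm hle ((Set.one_lt_ncard hfin).2
      ⟨v 0, ⟨v, rfl, hv⟩, _,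
        ⟨fun j => fischerVertex n p (n + (k + j * (p - 1))), ?_,
          isLeftPath_cycle hp hper hy⟩, hne⟩)
    simp

end FischerGraph

/-- for `g(β)` eventually periodic but not periodic with minimal `n ≥ 1`,
`p ≥ 1`: every left-ray `y` of `X_β` has `|r(y)| ≤ 2`, and `|r(y)| = 2` iff `y` is the
left-infinite word `(g_{n+1} ⋯ g_{n+p})^∞ g_{n+1} ⋯ g_{n+k}` for some `0 ≤ k < p`. -/
theorem statement12 (β : ℝ) (hβ : 1 < β) (n p : ℕ) (hn : 1 ≤ n) (hp : 1 ≤ p)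
    (hper : ∀ k, n ≤ k → genSeq β (k + p) = genSeq β k)
    (hmin : ∀ n' p' : ℕ, 1 ≤ p' →
      (∀ k, n' ≤ k → genSeq β (k + p') = genSeq β k) → n ≤ n' ∧ p ≤ p')
    (y : ℕ → ℕ) (hy : leftRay β y) :
    (termSet (genSeq β) n p y).ncard ≤ 2 ∧
      ((termSet (genSeq β) n p y).ncard = 2 ↔
        ∃ k : ℕ, k < p ∧
          ∀ j : ℕ, y j = genSeq β (n + (((k : ℤ) - 1 - j) % (p : ℤ)).toNat)) := by
  have hlast : genSeq β (n - 1) ≠ genSeq β (n + p - 1) := by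
    intro h
    have := (hmin (n - 1) p hp fun k hk => by
      rcases eq_or_lt_of_le hk with rfl | hk
      · rw [show n - 1 + p = n + p - 1 by omega, h]
      · exact hper k (by omega)).1
    omega
  have hg : ShiftMaximal (genSeq β) := by
    refine shiftMaximal_genSeq_of_not_periodic (by linarith) ?_
    rintro ⟨q, hq, hqper⟩
    have := (hmin 0 q hq fun k _ => hqper k).1
    omega
  have hmod : ∀ k j : ℕ, genSeq β (n + (((k : ℤ) - 1 - j) % (p : ℤ)).toNat) =
      genSeq β (n + (k + (j + 1) * (p - 1))) := by
    intro k j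
    refine apply_add_congr_mod hper ?_
    rw [← Int.natCast_modEq_iff, Int.toNat_of_nonneg (Int.emod_nonneg _ (by omega))]
    refine (Int.mod_modEq _ _).trans (Int.modEq_iff_dvd.2 ⟨j + 1, ?_⟩)
    push_cast [Nat.cast_sub hp]
    ring
  simp only [hmod]
  exact ncard_termSet hp hn hper hg (fun p' hp' h => (hmin n p' hp' h).2) hlast y
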